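/- arXiv:2604.15295 — 6 statements merged into one kernel-verified Lean document; each statement's English description precedes it below -/
import Mathlib

section
/- Let r, m be integers with 0 ≤ r ≤ m, let A be an invertible m×m matrix over 𝔽₂, and let b ∈ 𝔽₂^m; define the affine bijection T : 𝔽₂^m → 𝔽₂^m by T(v) = Av + b. If c ∈ RM(r,m), then the function v ↦ c(T(v)) also belongs to RM(r,m). In other words, the permutation automorphism group of RM(r,m) contains all invertible affine transformations of the index space 𝔽₂^m. -/
open MvPolynomial

/-- The evaluation linear map sending an `m`-variate polynomial over `𝔽₂` to its
evaluation function `𝔽₂^m → 𝔽₂`. -/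
noncomputable def rmEval (m : ℕ) :
    MvPolynomial (Fin m) (ZMod 2) →ₗ[ZMod 2] ((Fin m → ZMod 2) → ZMod 2) where
  toFun p := fun v => MvPolynomial.eval v p
  map_add' p q := by funext v; simp
  map_smul' a p := by funext v; simp

/-- The Reed–Muller code `RM(r,m)`. -/
noncomputable def RMcode (r m : ℕ) : Submodule (ZMod 2) ((Fin m → ZMod 2) → ZMod 2) :=
  (MvPolynomial.restrictTotalDegree (Fin m) (ZMod 2) r).map (rmEval m)

/-- Substituting polynomials of degree at most one does not raise the total degree. -/
theorem totalDegree_bind₁_le_of_affine {m r : ℕ} (L : Fin m → MvPolynomial (Fin m) (ZMod 2))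
    (hL : ∀ i, (L i).totalDegree ≤ 1) (p : MvPolynomial (Fin m) (ZMod 2))
    (hp : p.totalDegree ≤ r) : (bind₁ L p).totalDegree ≤ r := by
  rw [bind₁, aeval_def, eval₂_eq]
  apply totalDegree_finsetSum_le
  intro d hd
  refine (totalDegree_mul _ _).trans ?_
  rw [algebraMap_eq, totalDegree_C, zero_add]
  refine (totalDegree_finsetProd _ _).trans ?_
  refine le_trans ?_ ((le_totalDegree hd).trans hp)
  rw [Finsupp.sum]
  apply Finset.sum_le_sum
  intro i _
  refine (totalDegree_pow _ _).trans ?_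
  exact (Nat.mul_le_mul_left _ (hL i)).trans (by simp)

/-- The permutation automorphism group of `RM(r,m)` contains all invertible affine
transformations of the index space `𝔽₂^m`. -/
theorem rm_affine_automorphism (r m : ℕ) (hrm : r ≤ m)
    (A : Matrix (Fin m) (Fin m) (ZMod 2)) (hA : IsUnit A) (b : Fin m → ZMod 2)
    (c : (Fin m → ZMod 2) → ZMod 2) (hc : c ∈ RMcode r m) :
    (fun v => c (A.mulVec v + b)) ∈ RMcode r m := by
  obtain ⟨p, hp, rfl⟩ := hc
  have hp' : p.totalDegree ≤ r := (mem_restrictTotalDegree _ _ _).1 hp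
  let L : Fin m → MvPolynomial (Fin m) (ZMod 2) := fun i => (∑ j, C (A i j) * X j) + C (b i)
  refine ⟨bind₁ L p, (mem_restrictTotalDegree _ _ _).2
    (totalDegree_bind₁_le_of_affine L (fun i => ?_) p hp'), ?_⟩
  · refine (totalDegree_add _ _).trans (max_le ?_ (by simp))
    apply totalDegree_finsetSum_le
    intro j _
    refine (totalDegree_mul _ _).trans ?_
    simp
  · funext v
    change eval v (bind₁ L p) = eval (A.mulVec v + b) p
    have hLv : (fun i => eval v (L i)) = A.mulVec v + b := by
      funext i
      simp [L, Matrix.mulVec, dotProduct]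
    rw [← hLv]
    exact eval₂Hom_bind₁ (RingHom.id _) v L p
end

section
/- For integers m ≥ 1, 0 ≤ r ≤ m, and k ≥ 0, the Reed–Muller rates satisfy (Σ_{i=0}^{r} C(m+k,i)) / 2^{m+k} ≥ (Σ_{i=0}^{r} C(m,i)) / 2^{m} − k/(2√m), where the sums are of binomial coefficients and the inequality is between real numbers. Equivalently, R(RM(r,m+k)) ≥ R(RM(r,m)) − k/(2√m), where R denotes dimension divided by length. -/
lemma rm_cb (n : ℕ) : (2 * n + 1) * n.centralBinom ^ 2 ≤ 16 ^ n := by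
  induction n with
  | zero => simp
  | succ n ih =>
    have h := Nat.succ_mul_centralBinom_succ n
    have h2 : (n + 1) ^ 2 * ((2 * (n + 1) + 1) * (n + 1).centralBinom ^ 2)
        ≤ (n + 1) ^ 2 * 16 ^ (n + 1) := by
      calc (n + 1) ^ 2 * ((2 * (n + 1) + 1) * (n + 1).centralBinom ^ 2)
          = (2 * (n + 1) + 1) * ((n + 1) * (n + 1).centralBinom) ^ 2 := by ring
        _ = (4 * ((2 * n + 3) * (2 * n + 1))) * ((2 * n + 1) * n.centralBinom ^ 2) := by
            rw [h]; ring
        _ ≤ (16 * (n + 1) ^ 2) * 16 ^ n := by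
            apply Nat.mul_le_mul _ ih
            nlinarith
        _ = _ := by ring
    exact Nat.le_of_mul_le_mul_left h2 (by positivity)

lemma rm_choose (m r : ℕ) : m * (m.choose r) ^ 2 ≤ 4 ^ m := by
  refine le_trans (Nat.mul_le_mul_left m (Nat.pow_le_pow_left (Nat.choose_le_middle r m) 2)) ?_
  obtain ⟨n, h | h⟩ := Nat.even_or_odd' m
  · have e : m / 2 = n := by omega
    have h3 := rm_cb n
    rw [e, h, ← Nat.centralBinom_eq_two_mul_choose, pow_mul]
    norm_num
    nlinarith [Nat.zero_le (n.centralBinom ^ 2)]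
  · have e : m / 2 = n := by omega
    have h3 := rm_cb (n + 1)
    have h4 : (n + 1).centralBinom = 2 * (2 * n + 1).choose n := by
      rw [Nat.centralBinom_eq_two_mul_choose, show 2 * (n + 1) = 2 * n + 1 + 1 by ring,
        Nat.choose_succ_succ, Nat.choose_symm_half]
      ring
    rw [h4] at h3
    rw [e, h, pow_succ 4, pow_mul]
    rw [pow_succ 16] at h3
    norm_num
    nlinarith [Nat.zero_le ((2 * n + 1).choose n ^ 2)]

lemma rm_choose_real (m r : ℕ) (hm : 1 ≤ m) :
    (m.choose r : ℝ) / 2 ^ m ≤ 1 / Real.sqrt m := by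
  have hp : 0 < Real.sqrt m := Real.sqrt_pos.2 (by exact_mod_cast hm)
  rw [div_le_div_iff₀ (by positivity) hp, one_mul]
  apply le_of_sq_le_sq _ (by positivity)
  rw [mul_pow, Real.sq_sqrt (by positivity), ← pow_mul, mul_comm m 2, pow_mul]
  have := rm_choose m r
  norm_num
  rw [mul_comm]
  exact_mod_cast this

lemma rm_sum (m r : ℕ) :
    (∑ i ∈ Finset.range (r + 1), (Nat.choose (m + 1) i : ℝ)) =
      2 * (∑ i ∈ Finset.range (r + 1), (Nat.choose m i : ℝ)) - m.choose r := by
  induction r with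
  | zero => simp; norm_num
  | succ r ih =>
    rw [Finset.sum_range_succ, ih, Finset.sum_range_succ _ (r + 1), Nat.choose_succ_succ]
    push_cast
    ring

/-- Rate loss of Reed–Muller codes when the number of variables grows:
`R(RM(r,m+k)) ≥ R(RM(r,m)) − k/(2√m)`, where `R(RM(r,m))` is the dimension
`∑_{i=0}^r C(m,i)` divided by the length `2^m`. -/
theorem rm_rate_diff (r m k : ℕ) (hm : 1 ≤ m) (hrm : r ≤ m) :
    (∑ i ∈ Finset.range (r + 1), (Nat.choose (m + k) i : ℝ)) / 2 ^ (m + k) ≥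
      (∑ i ∈ Finset.range (r + 1), (Nat.choose m i : ℝ)) / 2 ^ m
        - (k : ℝ) / (2 * Real.sqrt m) := by
  induction k with
  | zero => simp
  | succ k ih =>
    have hp : 0 < Real.sqrt m := Real.sqrt_pos.2 (by exact_mod_cast hm)
    have h1 := rm_choose_real (m + k) r (by omega)
    have h2 : 1 / Real.sqrt ((m + k : ℕ) : ℝ) ≤ 1 / Real.sqrt m :=
      one_div_le_one_div_of_le hp (Real.sqrt_le_sqrt (by push_cast; linarith [Nat.cast_nonneg (α := ℝ) k]))
    have h3 : (∑ i ∈ Finset.range (r + 1), (Nat.choose (m + (k + 1)) i : ℝ)) / 2 ^ (m + (k + 1))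
        = (∑ i ∈ Finset.range (r + 1), (Nat.choose (m + k) i : ℝ)) / 2 ^ (m + k)
          - ((m + k).choose r : ℝ) / 2 ^ (m + k) / 2 := by
      rw [← add_assoc, rm_sum, pow_succ]
      field_simp
    have h4 : ((k + 1 : ℕ) : ℝ) / (2 * Real.sqrt m)
        = (k : ℝ) / (2 * Real.sqrt m) + 1 / Real.sqrt m / 2 := by
      push_cast
      field_simp
    rw [h3, h4]
    linarith
end

section
/- Let P be a d×d row-stochastic matrix over ℝ and α > 0 a real number such that P_{i,j} ≥ α for all i, j. Then for all probability row vectors x, y ∈ ℝ^d, ‖xP − yP‖₁ ≤ (1 − dα)·‖x − y‖₁. -/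
/-- Doeblin contraction under a uniform minorization condition: if `P` is a
`d × d` row-stochastic matrix with all entries at least `α > 0`, then for all
probability row vectors `x, y`, `‖xP − yP‖₁ ≤ (1 − dα)·‖x − y‖₁`. -/
theorem doeblin_contraction {d : ℕ} (P : Matrix (Fin d) (Fin d) ℝ) (α : ℝ)
    (hα : 0 < α) (hPα : ∀ i j, α ≤ P i j) (hProw : ∀ i, ∑ j, P i j = 1)
    (x y : Fin d → ℝ)
    (hx0 : ∀ i, 0 ≤ x i) (hx1 : ∑ i, x i = 1)
    (hy0 : ∀ i, 0 ≤ y i) (hy1 : ∑ i, y i = 1) :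
    ∑ j, |Matrix.vecMul x P j - Matrix.vecMul y P j| ≤
      (1 - d * α) * ∑ i, |x i - y i| := by
  have key : ∀ j, Matrix.vecMul x P j - Matrix.vecMul y P j
      = ∑ i, (x i - y i) * (P i j - α) := by
    intro j
    have h : ∑ i, (x i - y i) * (P i j - α)
        = (∑ i, x i * P i j - ∑ i, y i * P i j) - (∑ i, x i - ∑ i, y i) * α := by
      rw [← Finset.sum_sub_distrib, ← Finset.sum_sub_distrib, Finset.sum_mul,
        ← Finset.sum_sub_distrib]
      exact Finset.sum_congr rfl fun i _ => by ring
    rw [h, hx1, hy1]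
    simp [Matrix.vecMul, dotProduct]
  calc ∑ j, |Matrix.vecMul x P j - Matrix.vecMul y P j|
      ≤ ∑ j, ∑ i, |x i - y i| * (P i j - α) := by
        refine Finset.sum_le_sum fun j _ => ?_
        rw [key]
        refine (Finset.abs_sum_le_sum_abs _ _).trans (le_of_eq ?_)
        refine Finset.sum_congr rfl fun i _ => ?_
        rw [abs_mul, abs_of_nonneg (sub_nonneg.2 (hPα i j))]
    _ = (1 - d * α) * ∑ i, |x i - y i| := by
        rw [Finset.sum_comm, Finset.mul_sum]
        refine Finset.sum_congr rfl fun i _ => ?_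
        rw [← Finset.mul_sum, Finset.sum_sub_distrib, hProw]
        simp [mul_comm]
end

section
/- Let Q be a d×d row-stochastic matrix, π a probability row vector with πQ = π, and suppose there exist an integer k ≥ 1 and a real α > 0 such that every entry of Q^k is at least α. Fix integers T ≥ k and n ≥ 1. For 1 ≤ i ≤ n define the probability distribution P_{n,i} on d-ary sequences (s_0,…,s_{n−1}) by P_{n,i}(s_0,…,s_{n−1}) = (∏_{j=0}^{i−1} π(s_j)) · ∏_{j=i−1}^{n−2} (Q^T)_{s_j, s_{j+1}}. Then the total-variation distance satisfies (1/2) Σ_{(s_0,…,s_{n−1})} |P_{n,1}(s_0,…,s_{n−1}) − P_{n,n}(s_0,…,s_{n−1})| ≤ (n−1)(1 − dα)^{⌊T/k⌋}. (P_{n,1} is the law of the T-decimated stationary Markov chain and P_{n,n} is the product of its stationary marginals.) -/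
lemma tvaux_cons {d N : ℕ} (f : (Fin (N+1) → Fin d) → ℝ) :
    ∑ s, f s = ∑ x : Fin d, ∑ t : Fin N → Fin d, f (Fin.cons x t) := by
  rw [← (Fin.consEquiv (fun _ : Fin (N+1) => Fin d)).sum_comp, Fintype.sum_prod_type]
  rfl

lemma tvaux_main {d : ℕ} (R : Matrix (Fin d) (Fin d) ℝ) (hR0 : ∀ i j, 0 ≤ R i j)
    (hR1 : ∀ i, ∑ j, R i j = 1) (π : Fin d → ℝ) (hπ0 : ∀ i, 0 ≤ π i) (hπ1 : ∑ i, π i = 1)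
    (C : ℝ) (hC : ∀ x, ∑ j, |R x j - π j| ≤ C) (N : ℕ) :
    ∀ μ : Fin d → ℝ, (∀ i, 0 ≤ μ i) → ∑ i, μ i = 1 →
    ∑ s : Fin (N + 1) → Fin d, |μ (s 0) * ∏ j : Fin N, R (s j.castSucc) (s j.succ)
          - μ (s 0) * ∏ j : Fin N, π (s j.succ)| ≤ N * C := by
  induction N with
  | zero => intro μ _ _; simp
  | succ N ih =>
    intro μ h0 h1
    rw [tvaux_cons]
    have key : ∀ x : Fin d, ∑ t : Fin (N+1) → Fin d,
        |R x (t 0) * ∏ j : Fin N, R (t j.castSucc) (t j.succ)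
          - π (t 0) * ∏ j : Fin N, π (t j.succ)| ≤ N * C + C := by
      intro x
      have h2 : ∑ t : Fin (N+1) → Fin d, |R x (t 0) - π (t 0)| * ∏ j : Fin N, π (t j.succ) ≤ C := by
        rw [tvaux_cons]
        simp only [Fin.cons_zero, Fin.cons_succ, ← Finset.mul_sum]
        rw [← Fintype.sum_pow, hπ1]
        simpa using hC x
      refine le_trans ?_ (add_le_add (ih (R x) (hR0 x) (hR1 x)) h2)
      rw [← Finset.sum_add_distrib]
      refine Finset.sum_le_sum fun t _ => ?_
      have hB : 0 ≤ ∏ j : Fin N, π (t j.succ) := Finset.prod_nonneg fun _ _ => hπ0 _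
      have e : |R x (t 0) - π (t 0)| * ∏ j : Fin N, π (t j.succ)
          = |R x (t 0) * ∏ j : Fin N, π (t j.succ) - π (t 0) * ∏ j : Fin N, π (t j.succ)| := by
        rw [← sub_mul, abs_mul, abs_of_nonneg hB]
      rw [e]
      exact abs_sub_le _ _ _
    have : ∀ x : Fin d, ∑ t : Fin (N+1) → Fin d,
       |μ ((Fin.cons x t : Fin (N+2) → Fin d) 0) * ∏ j : Fin (N+1),
          R ((Fin.cons x t : Fin (N+2) → Fin d) j.castSucc) ((Fin.cons x t : Fin (N+2) → Fin d) j.succ)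
          - μ ((Fin.cons x t : Fin (N+2) → Fin d) 0) *
            ∏ j : Fin (N+1), π ((Fin.cons x t : Fin (N+2) → Fin d) j.succ)|
        ≤ μ x * (N * C + C) := by
      intro x
      refine le_trans (le_of_eq ?_) (mul_le_mul_of_nonneg_left (key x) (h0 x))
      rw [Finset.mul_sum]
      refine Finset.sum_congr rfl fun t _ => ?_
      rw [← mul_sub, abs_mul, Fin.cons_zero, abs_of_nonneg (h0 x)]
      congr 2
      simp only [Fin.cons_succ]
      rw [Fin.prod_univ_succ, Fin.prod_univ_succ]
      simp [← Fin.succ_castSucc]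
    refine le_trans (Finset.sum_le_sum fun x _ => this x) ?_
    rw [← Finset.sum_mul, h1]
    push_cast
    linarith

lemma tvaux_contr {d : ℕ} (M : Matrix (Fin d) (Fin d) ℝ) (hM1 : ∀ i, ∑ j, M i j = 1)
    (a : ℝ) (hM : ∀ i j, a ≤ M i j) (v : Fin d → ℝ) (hv : ∑ i, v i = 0) :
    ∑ j, |Matrix.vecMul v M j| ≤ (1 - d * a) * ∑ i, |v i| := by
  have h : ∀ j, |Matrix.vecMul v M j| ≤ ∑ i, |v i| * (M i j - a) := by
    intro j
    have : Matrix.vecMul v M j = ∑ i, v i * (M i j - a) := by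
      simp only [mul_sub, Finset.sum_sub_distrib, ← Finset.sum_mul, hv]
      simp [Matrix.vecMul, dotProduct]
    rw [this]
    refine (Finset.abs_sum_le_sum_abs _ _).trans (Finset.sum_le_sum fun i _ => ?_)
    rw [abs_mul, abs_of_nonneg (sub_nonneg.2 (hM i j))]
  refine (Finset.sum_le_sum fun j _ => h j).trans ?_
  rw [Finset.sum_comm]
  simp only [← Finset.mul_sum, Finset.sum_sub_distrib, hM1]
  simp [← Finset.sum_mul, mul_comm]

lemma tvaux_sum {d : ℕ} (M : Matrix (Fin d) (Fin d) ℝ) (hM1 : ∀ i, ∑ j, M i j = 1)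
    (v : Fin d → ℝ) : ∑ j, Matrix.vecMul v M j = ∑ i, v i := by
  simp only [Matrix.vecMul, dotProduct]
  rw [Finset.sum_comm]
  simp [← Finset.mul_sum, hM1]

lemma tvaux_stoch {d : ℕ} (Q : Matrix (Fin d) (Fin d) ℝ)
    (hQ0 : ∀ i j, 0 ≤ Q i j) (hQrow : ∀ i, ∑ j, Q i j = 1) (m : ℕ) :
    (∀ i j, 0 ≤ (Q ^ m) i j) ∧ ∀ i, ∑ j, (Q ^ m) i j = 1 := by
  induction m with
  | zero =>
    refine ⟨fun i j => ?_, fun i => ?_⟩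
    · simp only [pow_zero, Matrix.one_apply]; split_ifs <;> norm_num
    · simp [Matrix.one_apply]
  | succ m ih =>
    refine ⟨fun i j => ?_, fun i => ?_⟩
    · rw [pow_succ, Matrix.mul_apply]
      exact Finset.sum_nonneg fun l _ => mul_nonneg (ih.1 _ _) (hQ0 _ _)
    · rw [pow_succ, ← ih.2 i]
      exact tvaux_sum Q hQrow ((Q ^ m) i)

lemma tvaux_pow {d : ℕ} (M : Matrix (Fin d) (Fin d) ℝ) (hM1 : ∀ i, ∑ j, M i j = 1)
    (a : ℝ) (hM : ∀ i j, a ≤ M i j) (ha : 0 ≤ 1 - d * a) (v : Fin d → ℝ) (hv : ∑ i, v i = 0)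
    (m : ℕ) : ∑ i, Matrix.vecMul v (M ^ m) i = 0 ∧
      ∑ j, |Matrix.vecMul v (M ^ m) j| ≤ (1 - d * a) ^ m * ∑ i, |v i| := by
  induction m with
  | zero => simp [hv]
  | succ m ih =>
    rw [pow_succ, ← Matrix.vecMul_vecMul]
    refine ⟨by rw [tvaux_sum M hM1]; exact ih.1, ?_⟩
    refine (tvaux_contr M hM1 a hM _ ih.1).trans ?_
    rw [pow_succ, mul_comm (_ ^ m), mul_assoc]
    exact mul_le_mul_of_nonneg_left ih.2 ha


/-- Total-variation bound for the decimated Markov chain.  Here the number of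
samples is `n = N + 1 ≥ 1`.  `P_{n,1}`, the law of the `T`-decimated stationary
chain, assigns to a sequence `s` the value `π(s₀)·∏_{j=0}^{n-2} (Q^T)_{s_j,s_{j+1}}`,
while `P_{n,n}`, the product of stationary marginals, assigns `∏_{j=0}^{n-1} π(s_j)`.
Their total-variation distance is at most `(n−1)(1 − dα)^⌊T/k⌋`. -/
theorem decimated_chain_tv {d : ℕ} (Q : Matrix (Fin d) (Fin d) ℝ)
    (hQ0 : ∀ i j, 0 ≤ Q i j) (hQrow : ∀ i, ∑ j, Q i j = 1)
    (π : Fin d → ℝ) (hπ0 : ∀ i, 0 ≤ π i) (hπ1 : ∑ i, π i = 1)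
    (hπQ : Matrix.vecMul π Q = π)
    (k : ℕ) (hk : 1 ≤ k) (α : ℝ) (hα : 0 < α) (hQk : ∀ i j, α ≤ (Q ^ k) i j)
    (T : ℕ) (hT : k ≤ T) (N : ℕ) :
    (1 / 2 : ℝ) * ∑ s : Fin (N + 1) → Fin d,
        |π (s 0) * ∏ j : Fin N, (Q ^ T) (s j.castSucc) (s j.succ)
          - ∏ j : Fin (N + 1), π (s j)| ≤
      (N : ℝ) * (1 - d * α) ^ (T / k) := by

  have hst := tvaux_stoch Q hQ0 hQrow
  have hπm : ∀ m, Matrix.vecMul π (Q ^ m) = π := by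
    intro m
    induction m with
    | zero => simp
    | succ m ih => rw [pow_succ, ← Matrix.vecMul_vecMul, ih, hπQ]
  have hC : ∀ x, ∑ j, |(Q ^ T) x j - π j| ≤ 2 * (1 - d * α) ^ (T / k) := by
    intro x
    have ha : 0 ≤ 1 - d * α := by
      have : ∑ j : Fin d, α ≤ ∑ j, (Q ^ k) x j := Finset.sum_le_sum fun j _ => hQk x j
      rw [(hst k).2 x] at this
      simp at this
      linarith
    set v : Fin d → ℝ := Pi.single x 1 - π with hv
    have hv0 : ∑ i, v i = 0 := by simp [hv, hπ1]
    have hv2 : ∑ i, |v i| ≤ 2 := by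
      have : ∀ i, |v i| ≤ (Pi.single x 1 : Fin d → ℝ) i + π i := by
        intro i
        refine (abs_sub _ _).trans (le_of_eq ?_)
        rw [abs_of_nonneg (hπ0 i), abs_of_nonneg]
        rw [Pi.single_apply]; split_ifs <;> norm_num
      refine (Finset.sum_le_sum fun i _ => this i).trans ?_
      rw [Finset.sum_add_distrib, hπ1]
      simp
      norm_num
    have e : ∀ j, (Q ^ T) x j - π j = Matrix.vecMul v (Q ^ T) j := by
      intro j
      rw [hv, Matrix.sub_vecMul, hπm]
      simp
    simp only [e]
    have hp := tvaux_pow (Q ^ k) (hst k).2 α hQk ha v hv0 (T / k)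
    have hT' : Q ^ T = (Q ^ k) ^ (T / k) * Q ^ (T % k) := by
      rw [← pow_mul, ← pow_add, Nat.div_add_mod]
    rw [hT', ← Matrix.vecMul_vecMul]
    refine (tvaux_contr _ (hst (T % k)).2 0 (hst (T % k)).1 _ hp.1).trans ?_
    have h3 := mul_le_mul_of_nonneg_left hv2 (pow_nonneg ha (T / k))
    have h4 := hp.2
    linarith
  have hm := tvaux_main (Q ^ T) (hst T).1 (hst T).2 π hπ0 hπ1 _ hC N π hπ0 hπ1
  have e : ∀ s : Fin (N + 1) → Fin d, ∏ j, π (s j) = π (s 0) * ∏ j : Fin N, π (s j.succ) :=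
    fun s => Fin.prod_univ_succ _
  simp only [e]
  linarith
end

section
/- Consider a finite-state channel with finite input alphabet X, output alphabet Y, and state set S, given by a kernel K(y, s' | x, s) ≥ 0 with Σ_{y ∈ Y, s' ∈ S} K(y, s' | x, s) = 1 for all x, s, and with uniform state-transition matrix Φ̄_{s,s'} = (1/|X|) Σ_{x∈X} Σ_{y∈Y} K(y, s' | x, s). Suppose there exist an integer k ≥ 1 and a real α > 0 such that every entry of Φ̄^k is at least α, and let π be a probability vector with πΦ̄ = π. Then for all integers b, d, n ≥ 1 and every input sequence x = (x̄_0,…,x̄_{n−1}) ∈ (X^b)^n, the total-variation distance between the induced blocked-and-decimated channel output law W_n^{b↓d}(· | x) and the n-fold product of the stationary average block channel W̄_n^b(· | x) satisfies ‖W_n^{b↓d}(· | x) − W̄_n^b(· | x)‖_TV ≤ (n−1)·(1 − |S|α)^{⌊b(d−1)/k⌋}. -/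
section FSC

variable {X Y S : Type*} [Fintype X] [Fintype Y] [Fintype S] [DecidableEq S]

/-- The uniform state-transition matrix `Φ̄` of an FSC kernel `K(y, s' | x, s)`. -/
noncomputable def uniformPhi (K : Y → S → X → S → ℝ) : Matrix S S ℝ :=
  fun s s' => (1 / (Fintype.card X : ℝ)) * ∑ x : X, ∑ y : Y, K y s' x s

/-- The blocked kernel `K^b(yb, s' | xb, s)` for block size `b`: sum over all
internal state trajectories. -/
noncomputable def blockKernel (K : Y → S → X → S → ℝ) (b : ℕ)
    (yb : Fin b → Y) (s' : S) (xb : Fin b → X) (s : S) : ℝ :=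
  ∑ t : Fin (b + 1) → S,
    if t 0 = s ∧ t (Fin.last b) = s' then
      ∏ i : Fin b, K (yb i) (t i.succ) (xb i) (t i.castSucc)
    else 0

/-- The blocked-and-decimated kernel `K^{b↓d}(yb, s' | xb, s)`:  a block of `b`
channel uses followed by `b(d−1)` uniform-input transitions. -/
noncomputable def blockDecKernel (K : Y → S → X → S → ℝ) (b d : ℕ)
    (yb : Fin b → Y) (s' : S) (xb : Fin b → X) (s : S) : ℝ :=
  ∑ t : S, blockKernel K b yb t xb s * ((uniformPhi K) ^ (b * (d - 1))) t s'

/-- The induced channel `W_n^{b↓d}` on `n` protected blocks, with initial state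
drawn from `π`. -/
noncomputable def Wbd (K : Y → S → X → S → ℝ) (π : S → ℝ) (b d n : ℕ)
    (yb : Fin n → Fin b → Y) (xb : Fin n → Fin b → X) : ℝ :=
  ∑ σ : Fin (n + 1) → S,
    π (σ 0) * ∏ i : Fin n, blockDecKernel K b d (yb i) (σ i.succ) (xb i) (σ i.castSucc)

/-- The stationary average one-block channel `W̄^b(yb | xb)`. -/
noncomputable def Wbar (K : Y → S → X → S → ℝ) (π : S → ℝ) (b : ℕ)
    (yb : Fin b → Y) (xb : Fin b → X) : ℝ :=
  ∑ s : S, ∑ s' : S, π s * blockKernel K b yb s' xb s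

/-- Sum over trajectories of a time-inhomogeneous chain started from the weight `v`. -/
noncomputable def chainSum (n : ℕ) (v : S → ℝ) (D : Fin n → S → S → ℝ) : ℝ :=
  ∑ σ : Fin (n + 1) → S, v (σ 0) * ∏ i : Fin n, D i (σ i.succ) (σ i.castSucc)


lemma chainSum_zero (v : S → ℝ) (D : Fin 0 → S → S → ℝ) : chainSum 0 v D = ∑ s, v s := by
  unfold chainSum
  simp only [Finset.univ_eq_empty, Finset.prod_empty, mul_one]
  exact Fintype.sum_equiv (Equiv.funUnique (Fin 1) S) _ _ (fun σ => rfl)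

lemma sum_fin_cons {T : Type*} [Fintype T] (n : ℕ) (f : (Fin (n + 1) → T) → ℝ) :
    ∑ σ, f σ = ∑ s : T, ∑ τ : Fin n → T, f (Fin.cons s τ) := by
  rw [← Fintype.sum_prod_type' (f := fun s τ => f (Fin.cons s τ))]
  exact (Fintype.sum_equiv (Fin.consEquiv (fun _ => T)) _ _ (fun p => rfl)).symm

lemma chainSum_succ (n : ℕ) (v : S → ℝ) (D : Fin (n + 1) → S → S → ℝ) :
    chainSum (n + 1) v D =
      chainSum n (fun t => ∑ s, v s * D 0 t s) (fun i => D i.succ) := by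
  unfold chainSum
  rw [sum_fin_cons, Finset.sum_comm]
  refine Finset.sum_congr rfl fun τ _ => ?_
  rw [Finset.sum_mul]
  refine Finset.sum_congr rfl fun s _ => ?_
  rw [Fin.prod_univ_succ]
  simp [mul_assoc, ← Fin.succ_castSucc]

lemma chainSum_stoch (n : ℕ) (v : S → ℝ) (D : Fin n → S → S → ℝ)
    (hD : ∀ i s, ∑ t, D i t s = 1) : chainSum n v D = ∑ s, v s := by
  induction n generalizing v with
  | zero => exact chainSum_zero v D
  | succ n ih =>
    rw [chainSum_succ, ih _ _ (fun i s => hD i.succ s), Finset.sum_comm]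
    simp [← Finset.mul_sum, hD]

lemma chainSum_sum {Z : Type*} [Fintype Z] (n : ℕ) (v : S → ℝ) (D : Fin n → Z → S → S → ℝ)
    (hD : ∀ i s, ∑ z, ∑ t, D i z t s = 1) :
    ∑ z : Fin n → Z, chainSum n v (fun i => D i (z i)) = ∑ s, v s := by
  classical
  rw [← chainSum_stoch n v (fun i t s => ∑ z, D i z t s)
    (fun i s => by rw [Finset.sum_comm]; exact hD i s)]
  unfold chainSum
  rw [Finset.sum_comm]
  refine Finset.sum_congr rfl fun σ _ => ?_
  rw [← Finset.mul_sum, Finset.prod_univ_sum, Fintype.piFinset_univ]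

lemma chainSum_abs {Z : Type*} [Fintype Z] (n : ℕ) (v : S → ℝ) (D : Fin n → Z → S → S → ℝ)
    (hD0 : ∀ i z t s, 0 ≤ D i z t s)
    (hD : ∀ i s, ∑ z, ∑ t, D i z t s = 1) :
    ∑ z : Fin n → Z, |chainSum n v (fun i => D i (z i))| ≤ ∑ s, |v s| := by
  rw [← chainSum_sum n (fun s => |v s|) D hD]
  refine Finset.sum_le_sum fun z _ => ?_
  unfold chainSum
  refine (Finset.abs_sum_le_sum_abs _ _).trans (le_of_eq ?_)
  refine Finset.sum_congr rfl fun σ _ => ?_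
  rw [abs_mul, abs_of_nonneg (Finset.prod_nonneg fun i _ => hD0 _ _ _ _)]

lemma chainSum_sub_smul (n : ℕ) (v w : S → ℝ) (c : ℝ) (D : Fin n → S → S → ℝ) :
    chainSum n (fun s => v s - c * w s) D = chainSum n v D - c * chainSum n w D := by
  unfold chainSum
  rw [Finset.mul_sum, ← Finset.sum_sub_distrib]
  exact Finset.sum_congr rfl fun σ _ => by ring

lemma blockKernel_nonneg (K : Y → S → X → S → ℝ) (hK0 : ∀ y s' x s, 0 ≤ K y s' x s) (b : ℕ)
    (yb : Fin b → Y) (s' : S) (xb : Fin b → X) (s : S) : 0 ≤ blockKernel K b yb s' xb s := by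
  unfold blockKernel
  refine Finset.sum_nonneg fun t _ => ?_
  split_ifs
  · exact Finset.prod_nonneg fun i _ => hK0 _ _ _ _
  · exact le_rfl

lemma blockKernel_sum (K : Y → S → X → S → ℝ)
    (hK1 : ∀ x s, ∑ y : Y, ∑ s' : S, K y s' x s = 1) (b : ℕ) (xb : Fin b → X) (s : S) :
    ∑ yb : Fin b → Y, ∑ s' : S, blockKernel K b yb s' xb s = 1 := by
  have h := chainSum_sum b (fun t => if t = s then (1 : ℝ) else 0)
    (fun i y t' t => K y t' (xb i) t) (fun i s => hK1 (xb i) s)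
  simp only [Finset.sum_ite_eq', Finset.mem_univ, if_true] at h
  rw [← h]
  refine Finset.sum_congr rfl fun yb _ => ?_
  unfold blockKernel chainSum
  rw [Finset.sum_comm]
  refine Finset.sum_congr rfl fun t _ => ?_
  by_cases h0 : t 0 = s <;> simp [h0]

/-- One stochastic matrix with nonnegative entries does not expand the `ℓ¹` norm, and contracts
zero-sum vectors when all entries are bounded below. -/
lemma l1_vecMul_le (P : Matrix S S ℝ) (a : ℝ) (h0 : ∀ s t, a ≤ P s t)
    (h1 : ∀ s, ∑ t, P s t = 1) (v : S → ℝ) (hv : a * ∑ s, v s = 0) :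
    ∑ t, |Matrix.vecMul v P t| ≤ (1 - (Fintype.card S : ℝ) * a) * ∑ s, |v s| := by
  have e : ∀ t, Matrix.vecMul v P t = ∑ s, v s * (P s t - a) := by
    intro t
    simp only [Matrix.vecMul, dotProduct, mul_sub, Finset.sum_sub_distrib]
    rw [← Finset.sum_mul, mul_comm _ a, hv, sub_zero]
  calc ∑ t, |Matrix.vecMul v P t| ≤ ∑ t, ∑ s, |v s| * (P s t - a) := by
        refine Finset.sum_le_sum fun t _ => ?_
        rw [e]
        refine (Finset.abs_sum_le_sum_abs _ _).trans (le_of_eq ?_)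
        exact Finset.sum_congr rfl fun s _ => by
          rw [abs_mul, abs_of_nonneg (sub_nonneg.2 (h0 s t))]
    _ = _ := by
        rw [Finset.sum_comm, Finset.mul_sum]
        refine Finset.sum_congr rfl fun s _ => ?_
        rw [← Finset.mul_sum, Finset.sum_sub_distrib, h1]
        simp [mul_comm]

lemma sum_vecMul_stoch (P : Matrix S S ℝ) (h1 : ∀ s, ∑ t, P s t = 1) (v : S → ℝ) :
    ∑ t, Matrix.vecMul v P t = ∑ s, v s := by
  simp only [Matrix.vecMul, dotProduct]
  rw [Finset.sum_comm]
  simp [← Finset.mul_sum, h1]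

lemma pow_stoch (P : Matrix S S ℝ) (h0 : ∀ s t, 0 ≤ P s t) (h1 : ∀ s, ∑ t, P s t = 1) (m : ℕ) :
    (∀ s t, 0 ≤ (P ^ m) s t) ∧ ∀ s, ∑ t, (P ^ m) s t = 1 := by
  induction m with
  | zero =>
    refine ⟨fun s t => ?_, fun s => ?_⟩
    · rw [pow_zero, Matrix.one_apply]; split_ifs <;> norm_num
    · simp [Matrix.one_apply]
  | succ m ih =>
    refine ⟨fun s t => ?_, fun s => ?_⟩
    · rw [pow_succ, Matrix.mul_apply]
      exact Finset.sum_nonneg fun j _ => mul_nonneg (ih.1 _ _) (h0 _ _)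
    · simp only [pow_succ, Matrix.mul_apply]
      rw [Finset.sum_comm]
      simp [← Finset.mul_sum, h1, ih.2]

lemma l1_pow_le (P : Matrix S S ℝ) (a : ℝ) (h0 : ∀ s t, a ≤ P s t)
    (h1 : ∀ s, ∑ t, P s t = 1) (ha : 0 ≤ 1 - (Fintype.card S : ℝ) * a) (q : ℕ) (v : S → ℝ)
    (hv : ∑ s, v s = 0) :
    ∑ t, |Matrix.vecMul v (P ^ q) t| ≤ (1 - (Fintype.card S : ℝ) * a) ^ q * ∑ s, |v s| := by
  induction q generalizing v with
  | zero => simp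
  | succ q ih =>
    rw [pow_succ', ← Matrix.vecMul_vecMul]
    refine (ih _ (by rw [sum_vecMul_stoch P h1, hv])).trans ?_
    rw [pow_succ, mul_assoc]
    exact mul_le_mul_of_nonneg_left (l1_vecMul_le P a h0 h1 v (by rw [hv, mul_zero]))
      (pow_nonneg ha q)

/-- The telescoping bound, in `ℓ¹` form. -/
lemma tele_bound {Z V : Type*} [Fintype Z] (B : V → Z → S → S → ℝ) (M : Matrix S S ℝ) (π : S → ℝ)
    (hB0 : ∀ x z t s, 0 ≤ B x z t s) (hB1 : ∀ x s, ∑ z, ∑ t, B x z t s = 1)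
    (hM0 : ∀ s t, 0 ≤ M s t) (hM1 : ∀ s, ∑ t, M s t = 1)
    (hπ0 : ∀ s, 0 ≤ π s) (hπ1 : ∑ s, π s = 1) (hπM : Matrix.vecMul π M = π)
    (ρ : ℝ) (hρ0 : 0 ≤ ρ)
    (hρ : ∀ v : S → ℝ, ∑ s, v s = 0 → ∑ t, |Matrix.vecMul v M t| ≤ ρ * ∑ s, |v s|)
    (n : ℕ) (x : Fin (n + 1) → V) :
    ∑ z : Fin (n + 1) → Z,
      |chainSum (n + 1) π (fun i s' s => ∑ t, B (x i) (z i) t s * M t s')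
        - ∏ i, ∑ s, ∑ s', π s * B (x i) (z i) s' s| ≤ n * (2 * ρ) := by
  have key : ∀ (y : V) (z : Z), (fun t => ∑ s, π s * ∑ r, B y z r s * M r t) =
      Matrix.vecMul (fun r => ∑ s, π s * B y z r s) M := by
    intro y z
    funext t
    simp only [Matrix.vecMul, dotProduct, Finset.mul_sum, Finset.sum_mul]
    rw [Finset.sum_comm]
    exact Finset.sum_congr rfl fun _ _ => Finset.sum_congr rfl fun _ _ => by ring
  have hD0 : ∀ (y : V) (z : Z) (s' s : S), 0 ≤ ∑ t, B y z t s * M t s' := fun y z s' s =>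
    Finset.sum_nonneg fun t _ => mul_nonneg (hB0 _ _ _ _) (hM0 _ _)
  have hD1 : ∀ (y : V) (s : S), ∑ z, ∑ s', ∑ t, B y z t s * M t s' = 1 := by
    intro y s
    rw [← hB1 y s]
    refine Finset.sum_congr rfl fun z _ => ?_
    rw [Finset.sum_comm]
    simp [← Finset.mul_sum, hM1]
  have hc : ∀ (y : V) (z : Z), ∑ s, ∑ s', π s * B y z s' s = ∑ r, ∑ s, π s * B y z r s :=
    fun y z => Finset.sum_comm
  have hcsum : ∀ y : V, ∑ z, ∑ s, ∑ s', π s * B y z s' s = 1 := by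
    intro y
    rw [Finset.sum_comm, ← hπ1]
    refine Finset.sum_congr rfl fun s _ => ?_
    simp only [← Finset.mul_sum, hB1, mul_one]
  have hc0 : ∀ (y : V) (z : Z), 0 ≤ ∑ s, ∑ s', π s * B y z s' s := fun y z =>
    Finset.sum_nonneg fun s _ => Finset.sum_nonneg fun s' _ => mul_nonneg (hπ0 _) (hB0 _ _ _ _)
  induction n with
  | zero =>
    refine le_of_eq ?_
    rw [Nat.cast_zero, zero_mul]
    refine Finset.sum_eq_zero fun z _ => ?_
    rw [chainSum_succ, chainSum_zero, key, sum_vecMul_stoch M hM1, Fin.prod_univ_succ, hc]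
    simp
  | succ n ih =>
    rw [sum_fin_cons]
    have step : ∀ z0 : Z, ∑ τ : Fin (n + 1) → Z,
        |chainSum (n + 1 + 1) π
            (fun i s' s => ∑ t, B (x i) ((Fin.cons z0 τ : Fin (n + 1 + 1) → Z) i) t s * M t s')
          - ∏ i, ∑ s, ∑ s', π s * B (x i) ((Fin.cons z0 τ : Fin (n + 1 + 1) → Z) i) s' s| ≤
        (∑ s, ∑ s', π s * B (x 0) z0 s' s) * (2 * ρ)
         + (∑ s, ∑ s', π s * B (x 0) z0 s' s) * (n * (2 * ρ)) := by
      intro z0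
      set c := ∑ s, ∑ s', π s * B (x 0) z0 s' s with hcdef
      set u : S → ℝ := fun r => ∑ s, π s * B (x 0) z0 r s with hu
      have hu0 : ∀ r, 0 ≤ u r := fun r =>
        Finset.sum_nonneg fun s _ => mul_nonneg (hπ0 _) (hB0 _ _ _ _)
      have hus : ∑ r, u r = c := (hc (x 0) z0).symm
      have h1 := chainSum_abs (n + 1) (fun s => Matrix.vecMul u M s - c * π s)
        (fun i z s' s => ∑ t, B (x i.succ) z t s * M t s')
        (fun i z s' s => hD0 _ _ _ _) (fun i s => hD1 _ _)
      have h2 : ∑ s, |Matrix.vecMul u M s - c * π s| ≤ c * (2 * ρ) := by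
        have e : ∀ s, Matrix.vecMul u M s - c * π s = Matrix.vecMul (u - c • π) M s := by
          intro s
          rw [Matrix.sub_vecMul, Matrix.smul_vecMul, hπM]
          simp
        simp only [e]
        refine (hρ _ ?_).trans ?_
        · simp [Finset.sum_sub_distrib, ← Finset.mul_sum, hus, hπ1]
        · have : ∑ s, |(u - c • π) s| ≤ 2 * c := by
            calc ∑ s, |(u - c • π) s| ≤ ∑ s, (u s + c * π s) := by
                  refine Finset.sum_le_sum fun s _ => ?_
                  have a1 := hu0 s
                  have a2 := mul_nonneg (hc0 (x 0) z0) (hπ0 s)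
                  rw [← hcdef] at a2
                  simp only [Pi.sub_apply, Pi.smul_apply, smul_eq_mul]
                  rw [abs_le]; constructor <;> linarith
              _ = 2 * c := by
                  rw [Finset.sum_add_distrib, ← Finset.mul_sum, hus, hπ1]; ring
          nlinarith
      have h3 := mul_le_mul_of_nonneg_left (ih (fun i => x i.succ)) (hc0 (x 0) z0)
      rw [← hcdef] at h3
      refine le_trans ?_ (add_le_add (h1.trans h2) h3)
      rw [Finset.mul_sum, ← Finset.sum_add_distrib]
      refine Finset.sum_le_sum fun τ _ => ?_
      rw [chainSum_succ, Fin.prod_univ_succ]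
      simp only [Fin.cons_zero, Fin.cons_succ]
      have habs : ∀ r : ℝ, c * |r| = |c * r| := fun r => by
        rw [abs_mul, abs_of_nonneg (a := c) (hc0 (x 0) z0)]
      rw [key, chainSum_sub_smul, habs]
      refine le_trans (le_of_eq ?_) (abs_add_le _ _)
      congr 1
      ring
    refine (Finset.sum_le_sum fun z0 _ => step z0).trans (le_of_eq ?_)
    rw [Finset.sum_add_distrib, ← Finset.sum_mul, ← Finset.sum_mul, hcsum]
    push_cast
    ring

/-- Total-variation bound between the blocked-and-decimated FSC and the memoryless
stationary average block channel:
`‖W_n^{b↓d}(· | x) − W̄_n^b(· | x)‖_TV ≤ (n−1)(1 − |S|α)^⌊b(d−1)/k⌋`. -/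
theorem fsc_blocked_decimated_tv_bound (K : Y → S → X → S → ℝ)
    (hK0 : ∀ y s' x s, 0 ≤ K y s' x s)
    (hK1 : ∀ x s, ∑ y : Y, ∑ s' : S, K y s' x s = 1)
    (π : S → ℝ) (hπ0 : ∀ s, 0 ≤ π s) (hπ1 : ∑ s, π s = 1)
    (hπΦ : Matrix.vecMul π (uniformPhi K) = π)
    (k : ℕ) (hk : 1 ≤ k) (α : ℝ) (hα : 0 < α)
    (hΦk : ∀ s s', α ≤ ((uniformPhi K) ^ k) s s')
    (b d n : ℕ) (hb : 1 ≤ b) (hd : 1 ≤ d) (hn : 1 ≤ n)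
    (xb : Fin n → Fin b → X) :
    (1 / 2 : ℝ) * ∑ yb : Fin n → Fin b → Y,
        |Wbd K π b d n yb xb - ∏ i : Fin n, Wbar K π b (yb i) (xb i)| ≤
      ((n : ℝ) - 1) * (1 - (Fintype.card S : ℝ) * α) ^ ((b * (d - 1)) / k) := by
  have hX : (Fintype.card X : ℝ) ≠ 0 := by
    intro h
    have hz : uniformPhi K = 0 := by
      funext s s'
      simp [uniformPhi, h]
    rw [hz, Matrix.vecMul_zero] at hπΦ
    rw [← hπΦ] at hπ1
    simp at hπ1
  have hP0 : ∀ s t, 0 ≤ uniformPhi K s t := fun s t =>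
    mul_nonneg (by positivity) (Finset.sum_nonneg fun x _ => Finset.sum_nonneg fun y _ => hK0 _ _ _ _)
  have hP1 : ∀ s, ∑ t, uniformPhi K s t = 1 := by
    intro s
    unfold uniformPhi
    rw [← Finset.mul_sum, Finset.sum_comm]
    have : ∀ x : X, ∑ t, ∑ y, K y t x s = 1 := fun x => by rw [Finset.sum_comm]; exact hK1 x s
    simp [this, hX]
  have hpow := pow_stoch (uniformPhi K) hP0 hP1
  have hπpow : ∀ m : ℕ, Matrix.vecMul π ((uniformPhi K) ^ m) = π := by
    intro m
    induction m with
    | zero => simp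
    | succ m ih => rw [pow_succ, ← Matrix.vecMul_vecMul, ih, hπΦ]
  have ha : 0 ≤ 1 - (Fintype.card S : ℝ) * α := by
    have hS : Nonempty S := by
      by_contra h
      rw [not_nonempty_iff] at h
      simp at hπ1
    obtain ⟨s⟩ := hS
    have h := Finset.sum_le_sum (s := Finset.univ) fun t _ => hΦk s t
    rw [(hpow k).2 s] at h
    simp at h
    linarith
  set m := b * (d - 1) with hm
  have hρ : ∀ v : S → ℝ, ∑ s, v s = 0 → ∑ t, |Matrix.vecMul v ((uniformPhi K) ^ m) t| ≤
      (1 - (Fintype.card S : ℝ) * α) ^ (m / k) * ∑ s, |v s| := by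
    intro v hv
    have e : (uniformPhi K) ^ m = ((uniformPhi K) ^ k) ^ (m / k) * (uniformPhi K) ^ (m % k) := by
      rw [← pow_mul, ← pow_add, Nat.div_add_mod]
    rw [e, ← Matrix.vecMul_vecMul]
    refine (l1_vecMul_le _ 0 (hpow (m % k)).1 (hpow (m % k)).2 _ (by simp)).trans ?_
    simp only [mul_zero, sub_zero, one_mul]
    exact l1_pow_le _ α hΦk (hpow k).2 ha _ v hv
  obtain ⟨n, rfl⟩ : ∃ n', n = n' + 1 := ⟨n - 1, by omega⟩
  have h := tele_bound (fun (x : Fin b → X) (y : Fin b → Y) t s => blockKernel K b y t x s)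
    ((uniformPhi K) ^ m) π (fun x z t s => blockKernel_nonneg K hK0 b z t x s)
    (fun x s => blockKernel_sum K hK1 b x s) (hpow m).1 (hpow m).2 hπ0 hπ1 (hπpow m)
    ((1 - (Fintype.card S : ℝ) * α) ^ (m / k)) (pow_nonneg ha _) hρ n xb
  have h' : ∑ yb : Fin (n + 1) → Fin b → Y,
      |Wbd K π b d (n + 1) yb xb - ∏ i, Wbar K π b (yb i) (xb i)| ≤
      n * (2 * (1 - (Fintype.card S : ℝ) * α) ^ (m / k)) := h
  push_cast
  linarith

end FSC
end

section
/- Let X be a finite abelian group, Y a finite set, and W : X × Y → ℝ a channel (W(x,y) ≥ 0 and Σ_{y∈Y} W(x,y) = 1 for all x) that is translation symmetric: for every a ∈ X there exists a bijection σ_a : Y → Y with W(x + a, σ_a(y)) = W(x, y) for all x ∈ X, y ∈ Y. Fix N ≥ 1 and let D ⊆ E be subgroups of X^N. For a subgroup C ≤ X^N and coordinate i ∈ {0,…,N−1}, define the symbol-MAP error SER_C(i) = 1 − Σ_{y ∈ Y^N} max_{a ∈ X} (1/|C|) Σ_{c ∈ C, c_i = a} ∏_{j=0}^{N−1} W(c_j,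 y_j). Then for every coordinate i, SER_D(i) ≤ SER_E(i); i.e., the symbol-MAP error probability of a group subcode is at most that of the larger group code. -/
open scoped Classical

/-- The symbol-MAP error probability at coordinate `i` of a group code
`C ≤ X^N`, for a uniformly random codeword sent through the memoryless channel `W`:
`SER_C(i) = 1 − ∑_y max_a (1/|C|) ∑_{c ∈ C, c_i = a} ∏_j W(c_j, y_j)`. -/
noncomputable def symbolMapError {X Y : Type*} [AddCommGroup X] [Fintype X] [Fintype Y]
    [Nonempty X] {N : ℕ} (W : X → Y → ℝ) (C : AddSubgroup (Fin N → X)) (i : Fin N) : ℝ :=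
  1 - ∑ y : Fin N → Y,
      Finset.univ.sup' Finset.univ_nonempty (fun a : X =>
        (1 / (Nat.card C : ℝ)) *
          ∑ c : C, if (c : Fin N → X) i = a then ∏ j, W ((c : Fin N → X) j) (y j) else 0)

/-- Symbol-MAP error monotonicity for group subcodes on translation-symmetric
channels: if `D ≤ E` are subgroups of `X^N` and the channel `W` is matched to the
symbolwise translations of `X`, then `SER_D(i) ≤ SER_E(i)` for every coordinate. -/
theorem symbolMapError_subcode_le {X Y : Type*} [AddCommGroup X] [Fintype X] [Fintype Y]
    [Nonempty X] [Nonempty Y] (W : X → Y → ℝ)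
    (hW0 : ∀ x y, 0 ≤ W x y) (hW1 : ∀ x, ∑ y, W x y = 1)
    (hsym : ∀ a : X, ∃ σ : Equiv.Perm Y, ∀ x y, W (x + a) (σ y) = W x y)
    (N : ℕ) (hN : 1 ≤ N) (D E : AddSubgroup (Fin N → X)) (hDE : D ≤ E) (i : Fin N) :
    symbolMapError W D i ≤ symbolMapError W E i := by
  unfold symbolMapError
  apply sub_le_sub_left
  have hEpos : (0 : ℝ) < (Nat.card E : ℝ) := by exact_mod_cast Nat.card_pos
  have hDpos : (0 : ℝ) < (Nat.card D : ℝ) := by exact_mod_cast Nat.card_pos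
  have hDcard : ((Finset.univ : Finset D).card : ℝ) = (Nat.card D : ℝ) := by
    rw [Finset.card_univ, Nat.card_eq_fintype_card]
  have hEcard : ((Finset.univ : Finset E).card : ℝ) = (Nat.card E : ℝ) := by
    rw [Finset.card_univ, Nat.card_eq_fintype_card]
  choose σ hσ using hsym
  -- the score function of the coset `D + e`
  let g : (Fin N → X) → (Fin N → Y) → X → ℝ := fun e y a =>
    (1 / (Nat.card D : ℝ)) * ∑ d : D, if (d : Fin N → X) i + e i = a then
      ∏ j, W ((d : Fin N → X) j + e j) (y j) else 0
  let f : (Fin N → X) → (Fin N → Y) → ℝ := fun e y =>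
    Finset.univ.sup' Finset.univ_nonempty (g e y)
  let S : ℝ := ∑ y : Fin N → Y,
      Finset.univ.sup' Finset.univ_nonempty (fun a : X =>
        (1 / (Nat.card D : ℝ)) *
          ∑ c : D, if (c : Fin N → X) i = a then ∏ j, W ((c : Fin N → X) j) (y j) else 0)
  -- each coset has the same total score
  have h1 : ∀ e : Fin N → X, ∑ y, f e y ≤ S := by
    intro e
    rw [← Equiv.sum_comp (Equiv.piCongrRight fun j => σ (e j)) (f e)]
    apply Finset.sum_le_sum
    intro y _
    apply Finset.sup'_le
    intro a _
    refine le_trans (le_of_eq ?_) (Finset.le_sup' _ (Finset.mem_univ (a - e i)))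
    simp only [g, Equiv.piCongrRight_apply, Pi.map_apply, hσ, eq_sub_iff_add_eq]
  -- averaging over cosets
  have h2 : ∀ (y : Fin N → Y) (a : X),
      (1 / (Nat.card E : ℝ)) * (∑ c : E, if (c : Fin N → X) i = a then
        ∏ j, W ((c : Fin N → X) j) (y j) else 0)
      = (1 / (Nat.card E : ℝ)) * ∑ e : E, g e y a := by
    intro y a
    congr 1
    simp only [g]
    rw [← Finset.mul_sum, Finset.sum_comm]
    have h3 : ∀ d : D, (∑ e : E, if (d : Fin N → X) i + (e : Fin N → X) i = a then
        ∏ j, W ((d : Fin N → X) j + (e : Fin N → X) j) (y j) else 0)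
        = ∑ c : E, if (c : Fin N → X) i = a then
        ∏ j, W ((c : Fin N → X) j) (y j) else 0 := by
      intro d
      exact Equiv.sum_comp (Equiv.addLeft (⟨d, hDE d.2⟩ : E)) (fun c : E =>
        if (c : Fin N → X) i = a then ∏ j, W ((c : Fin N → X) j) (y j) else 0)
    rw [Finset.sum_congr rfl (fun d _ => h3 d), Finset.sum_const, nsmul_eq_mul, hDcard]
    field_simp
  calc _ ≤ ∑ y : Fin N → Y, (1 / (Nat.card E : ℝ)) * ∑ e : E, f e y := by
        apply Finset.sum_le_sum
        intro y _
        apply Finset.sup'_le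
        intro a _
        rw [h2]
        apply mul_le_mul_of_nonneg_left _ (by positivity)
        apply Finset.sum_le_sum
        intro e _
        exact Finset.le_sup' _ (Finset.mem_univ a)
    _ = (1 / (Nat.card E : ℝ)) * ∑ e : E, ∑ y : Fin N → Y, f e y := by
        rw [← Finset.mul_sum, Finset.sum_comm]
    _ ≤ (1 / (Nat.card E : ℝ)) * ∑ e : E, S := by
        apply mul_le_mul_of_nonneg_left _ (by positivity)
        exact Finset.sum_le_sum fun e _ => h1 e
    _ = S := by
        rw [Finset.sum_const, nsmul_eq_mul, hEcard]
        field_simp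
end
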